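/- Let $X \in \mathbb{R}^{n\times p}$ and $\lambda > 0$, and set $\alpha = 1/\lambda$. Then $\mathrm{tr}\big(X(X^\top X + \alpha I_p)^{-1}X^\top\big) \;\le\; \log\det\big(I_p + \lambda X^\top X\big) \;\le\; \lambda\, \mathrm{tr}(X^\top X)$. -/

import Mathlib

open Matrix

/-- Proposition 3.3 (MI--df comparison), eq. (3.12): with `α = 1/λ`,
`tr(X(XᵀX + αI)⁻¹Xᵀ) ≤ log det(I + λ XᵀX) ≤ λ tr(XᵀX)`. -/
theorem df_le_log_det_le_trace {n p : ℕ}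
    (X : Matrix (Fin n) (Fin p) ℝ) (lam : ℝ) (hlam : 0 < lam)
    (α : ℝ) (hα : α = 1 / lam) :
    (X * (Xᵀ * X + α • 1)⁻¹ * Xᵀ).trace ≤ Real.log (1 + lam • (Xᵀ * X)).det ∧
    Real.log (1 + lam • (Xᵀ * X)).det ≤ lam * (Xᵀ * X).trace := by
  have hαp : 0 < α := by rw [hα]; positivity
  have hps : (Xᵀ * X).PosSemidef := by
    simpa using Matrix.posSemidef_conjTranspose_mul_self X
  obtain ⟨U, V, d, hUV, hVU, hd, hA⟩ : ∃ (U V : Matrix (Fin p) (Fin p) ℝ) (d : Fin p → ℝ),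
      U * V = 1 ∧ V * U = 1 ∧ (∀ i, 0 ≤ d i) ∧ Xᵀ * X = U * diagonal d * V := by
    refine ⟨hps.1.eigenvectorUnitary, star (hps.1.eigenvectorUnitary : Matrix _ _ ℝ),
      hps.1.eigenvalues, ?_, ?_, hps.eigenvalues_nonneg, ?_⟩
    · simp
    · simp
    · have h := hps.1.spectral_theorem
      rw [Unitary.conjStarAlgAut_apply] at h
      exact h
  have htr : ∀ e : Fin p → ℝ, (U * diagonal e * V).trace = ∑ i, e i := by
    intro e
    rw [Matrix.trace_mul_comm, ← Matrix.mul_assoc, hVU, Matrix.one_mul, Matrix.trace_diagonal]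
  have hdet : ∀ e : Fin p → ℝ, (U * diagonal e * V).det = ∏ i, e i := by
    intro e
    rw [Matrix.det_mul_comm, ← Matrix.mul_assoc, hVU, Matrix.one_mul, Matrix.det_diagonal]
  have hmul : ∀ e f : Fin p → ℝ, (U * diagonal e * V) * (U * diagonal f * V)
      = U * diagonal (fun i => e i * f i) * V := by
    intro e f
    calc _ = U * diagonal e * (V * U) * diagonal f * V := by simp only [Matrix.mul_assoc]
      _ = _ := by rw [hVU, Matrix.mul_one, Matrix.mul_assoc U, Matrix.diagonal_mul_diagonal]
  have haff : ∀ a b : ℝ, a • (1 : Matrix (Fin p) (Fin p) ℝ) + b • (Xᵀ * X)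
      = U * diagonal (fun i => a + b * d i) * V := by
    intro a b
    have h : diagonal (fun i => a + b * d i)
        = a • (1 : Matrix (Fin p) (Fin p) ℝ) + b • diagonal d := by
      ext i j
      by_cases hij : i = j
      · subst hij; simp
      · simp [hij]
    rw [h, hA]
    simp [Matrix.mul_add, Matrix.add_mul, hUV]
  have hB : Xᵀ * X + α • 1 = U * diagonal (fun i => α + 1 * d i) * V := by
    rw [← haff, one_smul, add_comm]
  have hinv : (Xᵀ * X + α • 1)⁻¹ = U * diagonal (fun i => (α + 1 * d i)⁻¹) * V := by
    apply Matrix.inv_eq_right_inv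
    rw [hB, hmul]
    have : (fun i => (α + 1 * d i) * (α + 1 * d i)⁻¹) = fun _ => (1 : ℝ) := by
      funext i
      have := hd i
      exact mul_inv_cancel₀ (by positivity)
    rw [this, Matrix.diagonal_one, Matrix.mul_one, hUV]
  have hlog : Real.log (1 + lam • (Xᵀ * X)).det = ∑ i, Real.log (1 + lam * d i) := by
    have h := haff 1 lam
    rw [one_smul] at h
    rw [h, hdet, Real.log_prod]
    intro i _
    have := hd i
    positivity
  have h1 : (X * (Xᵀ * X + α • 1)⁻¹ * Xᵀ).trace = ∑ i, d i * (α + 1 * d i)⁻¹ := by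
    rw [Matrix.trace_mul_comm, ← Matrix.mul_assoc, hinv, hA, hmul, htr]
  have h2 : (Xᵀ * X).trace = ∑ i, d i := by rw [hA, htr]
  rw [hlog, h1, h2, Finset.mul_sum]
  constructor
  · refine Finset.sum_le_sum fun i _ => ?_
    have hi := hd i
    have hp : 0 < 1 + lam * d i := by positivity
    have h := Real.one_sub_inv_le_log_of_pos hp
    refine le_trans (le_of_eq ?_) h
    rw [hα]
    have : 1 / lam + 1 * d i = (1 + lam * d i) / lam := by field_simp
    rw [this]
    field_simp
    ring
  · refine Finset.sum_le_sum fun i _ => ?_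
    have hi := hd i
    have hp : 0 < 1 + lam * d i := by positivity
    have h := Real.log_le_sub_one_of_pos hp
    linarith
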